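/- arXiv:1604.03965 — 3 statements merged into one kernel-verified Lean document; each statement's English description precedes it below -/
import Mathlib

section
/- Let f ∈ ℤ[x] be a monic polynomial of degree at least 2. Suppose that (a,b) is a 2-cycle of f in ℚ (i.e., a ≠ b, f(a) = b and f(b) = a) and that e ∈ ℚ is a fixed point of f. Then 2e = a + b. -/
open Polynomial in
/-- A rational fixed point of a monic integer polynomial of degree at least `2` is an integer. -/
theorem exists_int_eq_of_aeval_eq_self {g : ℤ[X]} (hg : g.Monic) (hdeg : 2 ≤ g.natDegree)
    {x : ℚ} (hx : aeval x g = x) : ∃ n : ℤ, (n : ℚ) = x := by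
  have hlt : (X : ℤ[X]).degree < g.degree := by
    apply degree_lt_degree
    rw [natDegree_X]
    omega
  have hroot : aeval x (g - X) = 0 := by simp [hx]
  obtain ⟨n, hn⟩ := isInteger_of_is_root_of_monic (hg.sub_of_left hlt) hroot
  exact ⟨n, by simpa using hn⟩

/-- **Lemma (Baron).** Let `f ∈ ℤ[x]` be a monic polynomial of degree at least `2`.
If `(a, b)` is a `2`-cycle of `f` in `ℚ` and `e ∈ ℚ` is a fixed point of `f`, then
`2e = a + b`. -/
theorem two_cycle_fixed_point_relation
    (f : Polynomial ℤ) (hmonic : f.Monic) (hdeg : 2 ≤ f.natDegree)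
    (a b e : ℚ) (hab : a ≠ b)
    (hfa : Polynomial.aeval a f = b) (hfb : Polynomial.aeval b f = a)
    (hfe : Polynomial.aeval e f = e) :
    2 * e = a + b := by
  have hcomp : (f.comp f).Monic := hmonic.comp hmonic (by omega)
  have hcdeg : 2 ≤ (f.comp f).natDegree := by
    rw [Polynomial.natDegree_comp]
    nlinarith
  obtain ⟨a, rfl⟩ := exists_int_eq_of_aeval_eq_self hcomp hcdeg
    (by rw [Polynomial.aeval_comp, hfa, hfb])
  obtain ⟨b, rfl⟩ := exists_int_eq_of_aeval_eq_self hcomp hcdeg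
    (by rw [Polynomial.aeval_comp, hfb, hfa])
  obtain ⟨e, rfl⟩ := exists_int_eq_of_aeval_eq_self hmonic hdeg hfe
  have heval (m n : ℤ) (h : Polynomial.aeval (m : ℚ) f = n) : f.eval m = n := by
    have := Polynomial.aeval_algebraMap_apply_eq_algebraMap_eval (A := ℚ) m f
    simp only [algebraMap_int_eq, eq_intCast, h] at this
    exact_mod_cast this.symm
  have hba := f.sub_dvd_eval_sub a e
  have hbb := f.sub_dvd_eval_sub b e
  rw [heval a b hfa, heval e e hfe] at hba
  rw [heval b a hfb, heval e e hfe] at hbb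
  have hne : a ≠ b := by exact_mod_cast hab
  have key : 2 * e = a + b := by
    rcases Int.natAbs_eq_natAbs_iff.mp (Int.natAbs_eq_of_dvd_dvd hba hbb) with h | h <;> omega
  exact_mod_cast key
end

section
/- Let f ∈ ℤ[x] be a monic polynomial of degree at least 2. Suppose that (a,b) and (c,d) are two distinct 2-cycles of f in ℚ (i.e., a ≠ b, c ≠ d, f(a) = b, f(b) = a, f(c) = d, f(d) = c, and {a,b} ≠ {c,d}). Then a + b = c + d. -/
/-- A rational point of period dividing `2` of a monic integer polynomial of degree at least `2`
is an integer. -/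
theorem exists_int_cast_eq_of_aeval_aeval_eq {f : Polynomial ℤ} (hmonic : f.Monic)
    (hdeg : 2 ≤ f.natDegree) {x : ℚ} (hx : Polynomial.aeval (Polynomial.aeval x f) f = x) :
    ∃ n : ℤ, (n : ℚ) = x := by
  have hcomp : (f.comp f).Monic := hmonic.comp hmonic (by omega)
  have hp : (f.comp f - Polynomial.X).Monic := by
    refine hcomp.sub_of_left (Polynomial.degree_lt_degree ?_)
    rw [Polynomial.natDegree_X, Polynomial.natDegree_comp]
    nlinarith
  have hroot : Polynomial.aeval x (f.comp f - Polynomial.X) = 0 := by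
    rw [map_sub, Polynomial.aeval_comp, Polynomial.aeval_X, hx, sub_self]
  obtain ⟨n, hn⟩ := isInteger_of_is_root_of_monic hp hroot
  exact ⟨n, by simpa using hn⟩

/-- If an integer polynomial swaps `a, b` and swaps `c, d`, then `|a - c| = |b - d|`. -/
theorem sub_eq_or_eq_neg_of_eval_swap {f : Polynomial ℤ} {a b c d : ℤ}
    (hfa : f.eval a = b) (hfb : f.eval b = a) (hfc : f.eval c = d) (hfd : f.eval d = c) :
    a - c = b - d ∨ a - c = -(b - d) := by
  have h₁ := Polynomial.sub_dvd_eval_sub a c f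
  have h₂ := Polynomial.sub_dvd_eval_sub b d f
  rw [hfa, hfc] at h₁
  rw [hfb, hfd] at h₂
  exact Int.natAbs_eq_natAbs_iff.mp (Int.natAbs_eq_of_dvd_dvd h₁ h₂)


/-- **Lemma (Baron).** Let `f ∈ ℤ[x]` be a monic polynomial of degree at least `2`.
If `(a, b)` and `(c, d)` are two distinct `2`-cycles of `f` in `ℚ`, then `a + b = c + d`. -/
theorem two_cycles_same_sum
    (f : Polynomial ℤ) (hmonic : f.Monic) (hdeg : 2 ≤ f.natDegree)
    (a b c d : ℚ) (hab : a ≠ b) (hcd : c ≠ d)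
    (hfa : Polynomial.aeval a f = b) (hfb : Polynomial.aeval b f = a)
    (hfc : Polynomial.aeval c f = d) (hfd : Polynomial.aeval d f = c)
    (hdistinct : ({a, b} : Set ℚ) ≠ ({c, d} : Set ℚ)) :
    a + b = c + d := by
  obtain ⟨a, rfl⟩ := exists_int_cast_eq_of_aeval_aeval_eq hmonic hdeg (hfa ▸ hfb)
  obtain ⟨b, rfl⟩ := exists_int_cast_eq_of_aeval_aeval_eq hmonic hdeg (hfb ▸ hfa)
  obtain ⟨c, rfl⟩ := exists_int_cast_eq_of_aeval_aeval_eq hmonic hdeg (hfc ▸ hfd)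
  obtain ⟨d, rfl⟩ := exists_int_cast_eq_of_aeval_aeval_eq hmonic hdeg (hfd ▸ hfc)
  have eval_eq {m n : ℤ} (h : Polynomial.aeval (m : ℚ) f = n) : f.eval m = n := by
    have h' := Polynomial.aeval_algebraMap_apply_eq_algebraMap_eval (A := ℚ) m f
    rw [eq_intCast, eq_intCast, h] at h'
    exact_mod_cast h'.symm
  have h₁ := sub_eq_or_eq_neg_of_eval_swap (eval_eq hfa) (eval_eq hfb) (eval_eq hfc) (eval_eq hfd)
  have h₂ := sub_eq_or_eq_neg_of_eval_swap (eval_eq hfa) (eval_eq hfb) (eval_eq hfd) (eval_eq hfc)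
  have hne : a ≠ b := by exact_mod_cast hab
  have hsum : a + b = c + d := by omega
  exact_mod_cast hsum
end

section
/- Let f ∈ ℤ[x] be a monic polynomial of degree d ≥ 2. Then the number of periodic points of f in ℙ¹(ℚ) (including the fixed point at infinity) is at most d + 1; equivalently, f has at most d periodic points in ℚ. -/
open Polynomial in
/-- A rational periodic point of a monic integer polynomial of degree at least two is an
integer. -/
theorem exists_int_eq_of_iterate_aeval_eq {f : ℤ[X]} (hmonic : f.Monic)
    (hdeg : 2 ≤ f.natDegree) {P : ℚ} {n : ℕ} (hn : 0 < n)
    (hP : (fun x : ℚ => aeval x f)^[n] P = P) : ∃ m : ℤ, (m : ℚ) = P := by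
  have hnat (k : ℕ) : (f.comp^[k] X).natDegree = f.natDegree ^ k := by
    simp [natDegree_iterate_comp]
  have hmon (k : ℕ) : (f.comp^[k] X).Monic := by
    induction k with
    | zero => exact monic_X
    | succ k ih =>
      rw [Function.iterate_succ_apply']
      refine hmonic.comp ih ?_
      rw [hnat]
      positivity
  have heval (k : ℕ) : aeval P (f.comp^[k] X) = (fun x : ℚ => aeval x f)^[k] P := by
    induction k with
    | zero => simp
    | succ k ih => rw [Function.iterate_succ_apply', Function.iterate_succ_apply', aeval_comp, ih]
  have hint : IsIntegral ℤ P := by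
    refine ⟨f.comp^[n] X - X, (hmon n).sub_of_left ?_, ?_⟩
    · rw [degree_X, degree_eq_natDegree (hmon n).ne_zero, hnat]
      exact_mod_cast Nat.one_lt_pow hn.ne' hdeg
    · rw [← aeval_def, map_sub, heval, hP, aeval_X, sub_self]
  obtain ⟨m, hm⟩ := IsIntegrallyClosed.isIntegral_iff.mp hint
  exact ⟨m, by simpa using hm⟩

/-- If `a - b` divides `g a - g b` for all integers `a, b`, then every periodic point of `g` has
period dividing two. -/
theorem apply_apply_eq_of_iterate_eq {g : ℤ → ℤ} (hg : ∀ a b, a - b ∣ g a - g b)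
    {x : ℤ} {n : ℕ} (hn : 0 < n) (hx : g^[n] x = x) : g (g x) = x := by
  by_contra hne
  have hper (i : ℕ) : g^[i + n] x = g^[i] x := by
    rw [Function.iterate_add_apply, hx]
  have hne' (i : ℕ) : g^[i + 2] x ≠ g^[i] x := by
    intro h
    have hmul : g^[(n - 1) * i + i] x = x := by
      have : (n - 1) * i + i = n * i := by
        obtain ⟨m, rfl⟩ : ∃ m, n = m + 1 := ⟨n - 1, by omega⟩
        simp only [Nat.add_sub_cancel]
        ring
      rw [this, Function.iterate_mul]
      exact Function.iterate_fixed hx i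
    apply hne
    have h2 := congrArg (g^[(n - 1) * i]) h
    rw [← Function.iterate_add_apply, ← Function.iterate_add_apply, hmul,
      show (n - 1) * i + (i + 2) = 2 + ((n - 1) * i + i) by ring,
      Function.iterate_add_apply, hmul] at h2
    exact h2
  have hstep (i : ℕ) : g^[i + 1] x - g^[i] x ∣ g^[i + 2] x - g^[i + 1] x := by
    simpa only [Function.iterate_succ_apply'] using hg (g^[i + 1] x) (g^[i] x)
  have hdvd (i k : ℕ) : g^[i + 1] x - g^[i] x ∣ g^[i + k + 1] x - g^[i + k] x := by
    induction k with
    | zero => exact dvd_rfl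
    | succ k ih => exact ih.trans (hstep (i + k))
  have hconst (i : ℕ) : g^[i + 2] x - g^[i + 1] x = g^[i + 1] x - g^[i] x := by
    have h1 := hdvd (i + 1) (n - 1)
    rw [show i + 1 + (n - 1) = i + n by omega, show i + n + 1 = i + 1 + n by ring,
      hper, hper] at h1
    rcases Int.natAbs_eq_natAbs_iff.mp (Int.natAbs_eq_of_dvd_dvd h1 (hstep i)) with h | h
    · exact h
    · exact absurd (by linarith) (hne' i)
  have hdiff (i : ℕ) : g^[i + 1] x - g^[i] x = g x - x := by
    induction i with
    | zero => rfl
    | succ i ih => rw [← ih, ← hconst i]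
  have hlin (i : ℕ) : g^[i] x = x + i * (g x - x) := by
    induction i with
    | zero => simp
    | succ i ih =>
      have := hdiff i
      push_cast
      linarith
  have h0 := hlin n
  rw [hx, left_eq_add, mul_eq_zero] at h0
  have hfix : g x = x := by
    rcases h0 with h | h
    · omega
    · linarith
  exact hne (by rw [hfix, hfix])

/-- Two orbits of period dividing two of a map with `a - b ∣ g a - g b`, one of them not a fixed
point, have the same sum. -/
theorem add_apply_eq_add_apply {g : ℤ → ℤ} (hg : ∀ a b, a - b ∣ g a - g b) {a u : ℤ}
    (ha : g (g a) = a) (hne : g a ≠ a) (hu : g (g u) = u) : u + g u = a + g a := by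
  have h1 := hg a u
  have h2 := hg (g a) (g u)
  have h3 := hg a (g u)
  have h4 := hg (g a) u
  rw [ha, hu] at h2
  rw [hu] at h3
  rw [ha] at h4
  rcases Int.natAbs_eq_natAbs_iff.mp (Int.natAbs_eq_of_dvd_dvd h1 h2) with h | h <;>
  rcases Int.natAbs_eq_natAbs_iff.mp (Int.natAbs_eq_of_dvd_dvd h3 h4) with h' | h' <;> omega

open Polynomial in
/-- A monic integer polynomial `f` of degree at least two has at most `f.natDegree` integers
satisfying `f (f x) = x`. -/
theorem encard_eval_eval_eq_self_le {f : ℤ[X]} (hmonic : f.Monic) (hdeg : 2 ≤ f.natDegree) :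
    {x : ℤ | f.eval (f.eval x) = x}.encard ≤ (f.natDegree : ℕ∞) := by
  have key (q : ℤ[X]) (hq : q.natDegree < f.natDegree)
      (h : ∀ x : ℤ, f.eval (f.eval x) = x → (f - q).eval x = 0) :
      {x : ℤ | f.eval (f.eval x) = x}.encard ≤ (f.natDegree : ℕ∞) := by
    have hm : (f - q).Monic := hmonic.sub_of_left (degree_lt_degree hq)
    have hsub : {x : ℤ | f.eval (f.eval x) = x} ⊆ ((f - q).roots.toFinset : Set ℤ) := by
      intro x hx
      simpa [hm.ne_zero] using h x hx
    refine (Set.encard_le_encard hsub).trans ?_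
    rw [Set.encard_coe_eq_coe_finsetCard]
    have := (Multiset.toFinset_card_le _).trans (card_roots' (f - q))
    rw [natDegree_sub_eq_left_of_natDegree_lt hq] at this
    exact_mod_cast this
  by_cases hfix : ∀ x : ℤ, f.eval (f.eval x) = x → f.eval x = x
  · refine key X (by rw [natDegree_X]; omega) fun x hx => ?_
    simp [hfix x hx]
  · push Not at hfix
    obtain ⟨a, ha, hne⟩ := hfix
    refine key (C (a + f.eval a) - X) ?_ fun x hx => ?_
    · have := natDegree_sub_le (C (a + f.eval a)) (X : ℤ[X])
      rw [natDegree_C, natDegree_X] at this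
      omega
    · have := add_apply_eq_add_apply (fun a b => sub_dvd_eval_sub a b f) ha hne hx
      rw [eval_sub, eval_sub, eval_C, eval_X]
      linarith

/-- **Theorem (Baron).** A monic polynomial `f ∈ ℤ[x]` of degree `d ≥ 2` has at most
`d + 1` periodic points in `ℙ¹(ℚ)` (counting the fixed point at infinity); equivalently,
`f` has at most `d` periodic points in `ℚ`. -/
theorem monic_int_polynomial_periodic_points_le_degree
    (f : Polynomial ℤ) (hmonic : f.Monic) (hdeg : 2 ≤ f.natDegree) :
    {P : ℚ | ∃ n, 0 < n ∧ (fun x : ℚ => Polynomial.aeval x f)^[n] P = P}.encard ≤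
      (f.natDegree : ℕ∞) := by
  have hsub : {P : ℚ | ∃ n, 0 < n ∧ (fun x : ℚ => Polynomial.aeval x f)^[n] P = P} ⊆
      (Int.cast : ℤ → ℚ) '' {x : ℤ | f.eval (f.eval x) = x} := by
    rintro P ⟨n, hn, hP⟩
    obtain ⟨m, rfl⟩ := exists_int_eq_of_iterate_aeval_eq hmonic hdeg hn hP
    refine ⟨m, ?_, rfl⟩
    have hsemi : Function.Semiconj (Int.cast : ℤ → ℚ) (fun x => f.eval x)
        (fun x : ℚ => Polynomial.aeval x f) := fun x => by
      simpa using (Polynomial.aeval_algebraMap_apply ℚ x f).symm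
    rw [← hsemi.iterate_right n m, Int.cast_inj] at hP
    exact apply_apply_eq_of_iterate_eq (g := fun x => f.eval x)
      (fun a b => Polynomial.sub_dvd_eval_sub a b f) hn hP
  exact (Set.encard_le_encard hsub).trans
    ((Set.encard_image_le _ _).trans (encard_eval_eval_eq_self_le hmonic hdeg))
end
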